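/- arXiv:2403.12338 — 3 statements merged into one kernel-verified Lean document; each statement's English description precedes it below -/
import Mathlib

section
/- (Lemma 3.2(ii)) Let (x^n)_{n≥0} be generated by the stochastic inexact Halpern iteration with integrable random errors U_n, set σ_n = E‖U_n‖, and suppose Fix T ≠ ∅ and S := sup_{n≥1} Σ_{i=1}^{n} B_i^{n} σ_i < ∞. Then sup_{n≥0} E‖Tx^n − x^0‖ ≤ 2·dist(x^0, Fix T) + S, where dist(x^0, Fix T) = inf{‖x^0 − x*‖ : x* ∈ Fix T}. -/
open Finset MeasureTheory

/-- Splitting off the last factor and the last term of a sum weighted by tail products. -/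
lemma sum_Icc_prod_Icc_mul_succ {R : Type*} [CommSemiring R] (β a : ℕ → R) (n : ℕ) :
    ∑ i ∈ Finset.Icc 1 (n + 1), (∏ j ∈ Finset.Icc i (n + 1), β j) * a i =
      β (n + 1) * (∑ i ∈ Finset.Icc 1 n, (∏ j ∈ Finset.Icc i n, β j) * a i + a (n + 1)) := by
  rw [Finset.sum_Icc_succ_top (by omega), mul_add, Finset.mul_sum, Finset.Icc_self,
    Finset.prod_singleton]
  congr 1
  refine Finset.sum_congr rfl fun i hi => ?_
  rw [Finset.prod_Icc_succ_top (by have := Finset.mem_Icc.1 hi; omega)]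
  ring

/-- The distance of an inexact Halpern iterate to a fixed point exceeds that of the anchor by at
most the weighted sum of the error norms. -/
lemma norm_halpern_sub_fixedPoint_le {E : Type*} [NormedAddCommGroup E] [NormedSpace ℝ E]
    {T : E → E} (hT : ∀ x y : E, ‖T x - T y‖ ≤ ‖x - y‖) {y : E} (hy : T y = y)
    {β : ℕ → ℝ} (hβ : ∀ n, 1 ≤ n → 0 < β n ∧ β n < 1) {x u : ℕ → E}
    (hx : ∀ n, 1 ≤ n → x n = (1 - β n) • x 0 + β n • (T (x (n - 1)) + u n)) (n : ℕ) :
    ‖x n - y‖ ≤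
      ‖x 0 - y‖ + ∑ i ∈ Finset.Icc 1 n, (∏ j ∈ Finset.Icc i n, β j) * ‖u i‖ := by
  induction n with
  | zero => simp
  | succ n ih =>
    obtain ⟨hpos, hlt⟩ := hβ (n + 1) (by omega)
    have hstep : x (n + 1) - y =
        (1 - β (n + 1)) • (x 0 - y) + β (n + 1) • ((T (x n) - T y) + u (n + 1)) := by
      rw [hx (n + 1) (by omega), hy, Nat.add_sub_cancel]
      module
    calc ‖x (n + 1) - y‖
        ≤ (1 - β (n + 1)) * ‖x 0 - y‖ + β (n + 1) * ‖(T (x n) - T y) + u (n + 1)‖ := by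
          rw [hstep]
          refine (norm_add_le _ _).trans_eq ?_
          rw [norm_smul_of_nonneg (by linarith), norm_smul_of_nonneg hpos.le]
      _ ≤ (1 - β (n + 1)) * ‖x 0 - y‖ + β (n + 1) *
          ((‖x 0 - y‖ + ∑ i ∈ Finset.Icc 1 n, (∏ j ∈ Finset.Icc i n, β j) * ‖u i‖) +
            ‖u (n + 1)‖) := by
          gcongr
          exact (norm_add_le _ _).trans (by gcongr; exact (hT _ _).trans ih)
      _ = _ := by
          rw [sum_Icc_prod_Icc_mul_succ]
          ring

/-- **Lemma 3.2(ii).** If the weighted noise sums are uniformly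
bounded by `S`, then the anchor condition holds with
`κ̄ = 2·dist(x⁰, Fix T) + S`. -/
theorem stochastic_halpern_anchor_from_noise_summability
    (E : Type*) [NormedAddCommGroup E] [NormedSpace ℝ E] [FiniteDimensional ℝ E]
    (Ω : Type*) [MeasurableSpace Ω] (μ : Measure Ω) [IsProbabilityMeasure μ]
    (T : E → E) (hT : ∀ x y : E, ‖T x - T y‖ ≤ ‖x - y‖)
    (hfix : ∃ y : E, T y = y)
    (β : ℕ → ℝ) (hβ0 : β 0 = 0)
    (hβ : ∀ n, 1 ≤ n → 0 < β n ∧ β n < 1)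
    (hβmono : ∀ n, 1 ≤ n → β (n - 1) ≤ β n)
    (U : ℕ → Ω → E) (hUint : ∀ n, Integrable (U n) μ)
    (x0 : E) (x : ℕ → Ω → E) (hx0 : ∀ ω, x 0 ω = x0)
    (hx : ∀ ω, ∀ n, 1 ≤ n →
      x n ω = (1 - β n) • x0 + (β n) • (T (x (n - 1) ω) + U n ω))
    (σ : ℕ → ℝ) (hσ : ∀ n, σ n = ∫ ω, ‖U n ω‖ ∂μ)
    (S : ℝ)
    (hS : ∀ n, 1 ≤ n →
      (∑ i ∈ Finset.Icc 1 n, (∏ j ∈ Finset.Icc i n, β j) * σ i) ≤ S) :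
    ∀ n, (∫ ω, ‖T (x n ω) - x0‖ ∂μ) ≤
      2 * Metric.infDist x0 {y : E | T y = y} + S := by
  have hσ0 : ∀ n, 0 ≤ σ n := fun n => by
    rw [hσ]
    exact integral_nonneg fun ω => norm_nonneg _
  have hsum : ∀ n, ∑ i ∈ Finset.Icc 1 n, (∏ j ∈ Finset.Icc i n, β j) * σ i ≤ S := by
    intro n
    rcases Nat.eq_zero_or_pos n with rfl | hn
    · have hS1 := hS 1 le_rfl
      simp only [Finset.Icc_self, Finset.sum_singleton, Finset.prod_singleton] at hS1
      simpa using (mul_nonneg (hβ 1 le_rfl).1.le (hσ0 1)).trans hS1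
    · exact hS n hn
  intro n
  suffices h : ((∫ ω, ‖T (x n ω) - x0‖ ∂μ) - S) / 2 ≤
      Metric.infDist x0 {y : E | T y = y} by linarith
  refine (Metric.le_infDist hfix).2 fun {y} hy => ?_
  have hy : T y = y := hy
  rw [dist_eq_norm]
  have hterm : ∀ i ∈ Finset.Icc 1 n,
      Integrable (fun ω => (∏ j ∈ Finset.Icc i n, β j) * ‖U i ω‖) μ :=
    fun i _ => (hUint i).norm.const_mul _
  have hpt : ∀ ω, ‖T (x n ω) - x0‖ ≤ 2 * ‖x0 - y‖ +
      ∑ i ∈ Finset.Icc 1 n, (∏ j ∈ Finset.Icc i n, β j) * ‖U i ω‖ := by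
    intro ω
    have hbound := norm_halpern_sub_fixedPoint_le hT hy hβ (x := fun k => x k ω)
      (u := fun k => U k ω) (fun k hk => by rw [hx ω k hk, hx0]) n
    have hlip := hT (x n ω) y
    have htri := norm_sub_le_norm_sub_add_norm_sub (T (x n ω)) y x0
    rw [hy] at hlip
    rw [norm_sub_rev y x0] at htri
    simp only [hx0] at hbound
    linarith
  have hint := integral_mono_of_nonneg (μ := μ) (.of_forall fun ω => norm_nonneg _)
    ((integrable_const (2 * ‖x0 - y‖)).add (integrable_finsetSum _ hterm)) (.of_forall hpt)
  simp only [Pi.add_apply] at hint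
  rw [integral_add (integrable_const _) (integrable_finsetSum _ hterm),
    integral_finsetSum _ hterm] at hint
  simp only [integral_const, probReal_univ, one_smul, integral_const_mul, ← hσ] at hint
  linarith [hsum n]
end

section
/- (Corollary 3.4, explicit form) Let (x^n)_{n≥0} be generated by the stochastic inexact Halpern iteration with stepsize β_n = n/(n+1) and integrable random errors U_n satisfying σ_n = E‖U_n‖ ≤ μσ/n² for all n ≥ 1, where μ, σ > 0 are constants. Assume there is κ̄ < ∞ with sup_{n≥0} E‖Tx^n − x^0‖ ≤ κ̄. Then for every N ≥ 1, E‖x^N − Tx^N‖ ≤ (1/(N+1)) ( κ̄ + (κ̄ + 2μσ)(log N + 1) ). -/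
open Finset MeasureTheory

lemma two_div_two_mul_add_one_le_log_succ_sub_log {n : ℝ} (hn : 0 < n) :
    2 / (2 * n + 1) ≤ Real.log (n + 1) - Real.log n := by
  have h := Real.le_log_one_add_of_nonneg (x := 1 / n) (by positivity)
  have e : 1 + 1 / n = (n + 1) / n := by field_simp
  rw [e, Real.log_div (by positivity) hn.ne'] at h
  refine le_trans (le_of_eq ?_) h
  field_simp
  ring

lemma inv_succ_le_log_succ_sub_log {n : ℝ} (hn : 0 < n) :
    1 / (n + 1) ≤ Real.log (n + 1) - Real.log n := by
  refine le_trans ?_ (two_div_two_mul_add_one_le_log_succ_sub_log hn)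
  rw [div_le_div_iff₀ (by positivity) (by positivity)]
  linarith

lemma thirteen_twelfths_le_log_three : 13 / 12 ≤ Real.log 3 := by
  have h : Real.log ((2 : ℝ) ^ 11) ≤ Real.log ((3 : ℝ) ^ 7) :=
    Real.log_le_log (by norm_num) (by norm_num)
  rw [Real.log_pow, Real.log_pow] at h
  push_cast at h
  linarith [Real.log_two_gt_d9]

lemma sum_inv_le_log_add_three_quarters {n : ℕ} (hn : 3 ≤ n) :
    ∑ k ∈ range n, 1 / ((k : ℝ) + 1) ≤ Real.log n + 3 / 4 := by
  induction n, hn using Nat.le_induction with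
  | base =>
    norm_num [sum_range_succ]
    linarith [thirteen_twelfths_le_log_three]
  | succ n hn ih =>
    have hpos : (0 : ℝ) < n := by positivity
    rw [sum_range_succ]
    push_cast
    linarith [inv_succ_le_log_succ_sub_log hpos]

lemma sum_inv_le_log_succ_sub {n : ℕ} (hn : 3 ≤ n) :
    ∑ k ∈ range n, 1 / ((k : ℝ) + 1) ≤
      Real.log (n + 1) + 7 / 12 - 2 / (4 * n + 3) := by
  induction n, hn using Nat.le_induction with
  | base =>
    have h : Real.log 4 = 2 * Real.log 2 := by
      rw [show (4 : ℝ) = 2 ^ 2 by norm_num, Real.log_pow]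
      norm_num
    norm_num [sum_range_succ]
    linarith [Real.log_two_gt_d9]
  | succ n hn ih =>
    have hpos : (0 : ℝ) < (n : ℝ) + 1 := by positivity
    have h := two_div_two_mul_add_one_le_log_succ_sub_log hpos
    have h2 : 1 / ((n : ℝ) + 1) - 2 / (2 * (n + 1) + 1) ≤
        2 / (4 * n + 3) - 2 / (4 * (n + 1) + 3) := by
      rw [div_sub_div _ _ (by positivity) (by positivity),
        div_sub_div _ _ (by positivity) (by positivity),
        div_le_div_iff₀ (by positivity) (by positivity)]
      have : (0 : ℝ) ≤ n := by positivity
      nlinarith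
    rw [sum_range_succ]
    push_cast
    linarith

lemma sum_inv_le_log_succ_add_seven_twelfths {n : ℕ} (hn : 2 ≤ n) :
    ∑ k ∈ range n, 1 / ((k : ℝ) + 1) ≤ Real.log (n + 1) + 7 / 12 := by
  rcases hn.eq_or_lt with rfl | h
  · norm_num [sum_range_succ]
    linarith [thirteen_twelfths_le_log_three]
  · have : (0 : ℝ) ≤ 2 / (4 * n + 3) := by positivity
    linarith [sum_inv_le_log_succ_sub h]

lemma le_sum_inv_of_increment_le {κ s : ℝ} {w : ℕ → ℝ} (h0 : w 0 ≤ κ + s) (h1 : w 1 ≤ 6 * κ)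
    (hstep : ∀ m : ℕ, w (m + 1) ≤ w m + κ / (m + 2) + 2 * s / (m + 1)) {n : ℕ} (hn : 1 ≤ n) :
    w n ≤ κ * (∑ k ∈ range (n + 1), 1 / ((k : ℝ) + 1) + 1 / 4) +
      s * (5 / 6 + 2 * ∑ k ∈ range n, 1 / ((k : ℝ) + 1)) := by
  induction n, hn using Nat.le_induction with
  | base =>
    have := hstep 0
    norm_num [sum_range_succ] at this ⊢
    linarith
  | succ n hn ih =>
    rw [sum_range_succ _ (n + 1), sum_range_succ _ n] at *
    have e1 : κ / ((n : ℝ) + 2) = κ * (1 / ((n + 1 : ℕ) + 1)) := by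
      push_cast
      rw [show (n : ℝ) + 1 + 1 = n + 2 by ring]
      ring
    have e2 : 2 * s / ((n : ℝ) + 1) = s * (2 * (1 / (n + 1))) := by ring
    have := hstep n
    rw [e1, e2] at this
    linarith

lemma log_bound_of_increment_le {κ s : ℝ} (hκ : 0 ≤ κ) (hs : 0 ≤ s) {w : ℕ → ℝ}
    (h0 : w 0 ≤ κ + s) (h1 : w 1 ≤ 6 * κ)
    (hstep : ∀ m : ℕ, w (m + 1) ≤ w m + κ / (m + 2) + 2 * s / (m + 1)) (n : ℕ) :
    ((n : ℝ) + 1) / (n + 2) * w n + s / (n + 1) ≤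
      (κ + 2 * s) * (Real.log (n + 1) + 1) := by
  rcases Nat.lt_or_ge n 2 with hn | hn
  · interval_cases n
    · norm_num
      linarith
    · have := hstep 0
      norm_num at this ⊢
      have hl : (1 / 2 : ℝ) ≤ Real.log 2 := by linarith [Real.log_two_gt_d9]
      have := mul_le_mul_of_nonneg_left hl (by linarith : 0 ≤ κ + 2 * s)
      linarith
  · have hw := le_sum_inv_of_increment_le h0 h1 hstep (by lia : 1 ≤ n)
    have ha := sum_inv_le_log_add_three_quarters (by lia : 3 ≤ n + 1)
    have hb := sum_inv_le_log_succ_add_seven_twelfths hn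
    push_cast at ha
    set B := (κ + 2 * s) * (Real.log (n + 1) + 1) with hB
    have hwB : w n ≤ B := by
      have := mul_le_mul_of_nonneg_left ha hκ
      have := mul_le_mul_of_nonneg_left hb hs
      rw [hB]
      linarith
    have hl : 0 ≤ Real.log ((n : ℝ) + 1) := Real.log_nonneg (by
      have : (0 : ℝ) ≤ n := by positivity
      linarith)
    have hsB : 2 * s ≤ B := by
      have := mul_nonneg (by linarith : 0 ≤ κ + 2 * s) hl
      rw [hB]
      linarith
    have hn0 : (0 : ℝ) ≤ n := by positivity
    have h3 : s / ((n : ℝ) + 1) ≤ B / (n + 2) := by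
      rw [div_le_div_iff₀ (by positivity) (by positivity)]
      nlinarith
    calc ((n : ℝ) + 1) / (n + 2) * w n + s / (n + 1)
        ≤ ((n : ℝ) + 1) / (n + 2) * B + B / (n + 2) := by gcongr
      _ = B := by field_simp; ring

section Halpern

variable {E : Type*} [NormedAddCommGroup E] [NormedSpace ℝ E]

lemma norm_halpern_increment_le {x0 a t₀ t₁ u₁ u₂ b : E} (m : ℕ)
    (ha : a = (1 - ((m : ℝ) + 1) / (m + 2)) • x0 + (((m : ℝ) + 1) / (m + 2)) • (t₀ + u₁))
    (hb : b = (1 - ((m : ℝ) + 2) / (m + 3)) • x0 + (((m : ℝ) + 2) / (m + 3)) • (t₁ + u₂)) :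
    ((m : ℝ) + 3) * ‖b - a‖ ≤ 1 / ((m : ℝ) + 2) * ‖t₀ - x0‖ + (m + 2) * ‖t₁ - t₀‖
      + (m + 2) * ‖u₂‖ + ((m + 1) * (m + 3) / (m + 2)) * ‖u₁‖ := by
  have e : ((m : ℝ) + 3) • (b - a) = (1 / ((m : ℝ) + 2)) • (t₀ - x0) +
      ((m : ℝ) + 2) • (t₁ - t₀) + ((m : ℝ) + 2) • u₂ -
      (((m : ℝ) + 1) * (m + 3) / (m + 2)) • u₁ := by
    rw [ha, hb]
    match_scalars <;> field_simp <;> ring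
  have hn {c : ℝ} (hc : 0 ≤ c) (v : E) : ‖c • v‖ = c * ‖v‖ := norm_smul_of_nonneg hc v
  rw [← hn (by positivity), e]
  refine (norm_sub_le _ _).trans ?_
  rw [hn (by positivity) u₁]
  gcongr
  refine norm_add₃_le.trans ?_
  rw [hn (by positivity), hn (by positivity), hn (by positivity)]

lemma norm_halpern_residual_le {x0 a t₀ t₁ u : E} (n : ℕ)
    (ha : a = (1 - ((n : ℝ) + 1) / (n + 2)) • x0 + (((n : ℝ) + 1) / (n + 2)) • (t₀ + u)) :
    ((n : ℝ) + 2) * ‖a - t₁‖ ≤ ‖t₁ - x0‖ + (n + 1) * ‖t₁ - t₀‖ + (n + 1) * ‖u‖ := by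
  have e : ((n : ℝ) + 2) • (a - t₁) = -(t₁ - x0) +
      -(((n : ℝ) + 1) • (t₁ - t₀)) + ((n : ℝ) + 1) • u := by
    rw [ha]
    match_scalars <;> field_simp <;> ring
  have hn {c : ℝ} (hc : 0 ≤ c) (v : E) : ‖c • v‖ = c * ‖v‖ := norm_smul_of_nonneg hc v
  rw [← hn (by positivity), e]
  refine norm_add₃_le.trans ?_
  rw [norm_neg, norm_neg, hn (by positivity), hn (by positivity)]

end Halpern

lemma integrable_comp_of_nonexpansive {E Ω : Type*} [NormedAddCommGroup E] [MeasurableSpace Ω]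
    {μ : Measure Ω} [IsFiniteMeasure μ] {T : E → E} (hT : ∀ x y : E, ‖T x - T y‖ ≤ ‖x - y‖)
    {f : Ω → E} (hf : Integrable f μ) : Integrable (fun ω ↦ T (f ω)) μ := by
  have hc : Continuous T := by
    refine (LipschitzWith.of_dist_le_mul (K := 1) fun x y ↦ ?_).continuous
    simpa [dist_eq_norm] using hT x y
  refine (hf.norm.add (integrable_const ‖T 0‖)).mono'
    (hc.comp_aestronglyMeasurable hf.aestronglyMeasurable) (.of_forall fun ω ↦ ?_)
  have h1 := hT (f ω) 0
  have h2 := norm_sub_norm_le (T (f ω)) (T 0)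
  rw [sub_zero] at h1
  simp only [Pi.add_apply]
  linarith

/-- **Corollary 3.4, explicit form.** With `σ_n ≤ μσ/n²` the
stochastic Halpern iteration with stepsize `n/(n+1)` satisfies a logarithmic
residual bound. -/
theorem stochastic_halpern_rate_bounded_variance
    (E : Type*) [NormedAddCommGroup E] [NormedSpace ℝ E] [FiniteDimensional ℝ E]
    (Ω : Type*) [MeasurableSpace Ω] (μ : Measure Ω) [IsProbabilityMeasure μ]
    (T : E → E) (hT : ∀ x y : E, ‖T x - T y‖ ≤ ‖x - y‖)
    (U : ℕ → Ω → E) (hUint : ∀ n, Integrable (U n) μ)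
    (x0 : E) (x : ℕ → Ω → E) (hx0 : ∀ ω, x 0 ω = x0)
    (hx : ∀ ω, ∀ n, 1 ≤ n →
      x n ω = (1 - (n : ℝ) / (n + 1)) • x0
        + ((n : ℝ) / (n + 1)) • (T (x (n - 1) ω) + U n ω))
    (mu sig : ℝ) (hmu : 0 < mu) (hsig : 0 < sig)
    (hσn : ∀ n, 1 ≤ n → (∫ ω, ‖U n ω‖ ∂μ) ≤ mu * sig / (n : ℝ) ^ 2)
    (κbar : ℝ) (hκbar : ∀ n, (∫ ω, ‖T (x n ω) - x0‖ ∂μ) ≤ κbar) :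
    ∀ N, 1 ≤ N →
      (∫ ω, ‖x N ω - T (x N ω)‖ ∂μ) ≤
        (1 / ((N : ℝ) + 1)) *
          (κbar + (κbar + 2 * mu * sig) * (Real.log N + 1)) := by
  have hxs (n : ℕ) (ω : Ω) : x (n + 1) ω = (1 - ((n : ℝ) + 1) / (n + 2)) • x0
      + (((n : ℝ) + 1) / (n + 2)) • (T (x n ω) + U (n + 1) ω) := by
    have := hx ω (n + 1) (by lia)
    push_cast at this
    rwa [show (n : ℝ) + 1 + 1 = n + 2 by ring] at this
  have hxss (n : ℕ) (ω : Ω) : x (n + 2) ω = (1 - ((n : ℝ) + 2) / (n + 3)) • x0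
      + (((n : ℝ) + 2) / (n + 3)) • (T (x (n + 1) ω) + U (n + 2) ω) := by
    have := hxs (n + 1) ω
    push_cast at this
    rwa [show (n : ℝ) + 1 + 1 = n + 2 by ring, show (n : ℝ) + 1 + 2 = n + 3 by ring] at this
  have hxi (n : ℕ) : Integrable (x n) μ := by
    induction n with
    | zero => rw [funext hx0]; exact integrable_const _
    | succ n ih =>
      rw [funext (hxs n)]
      exact (integrable_const _).add
        (((integrable_comp_of_nonexpansive hT ih).add (hUint (n + 1))).smul _)
  have hTi (n : ℕ) := integrable_comp_of_nonexpansive hT (hxi n)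
  have hUi (n : ℕ) : Integrable (fun ω ↦ ‖U n ω‖) μ := (hUint n).norm
  have hKi (n : ℕ) : Integrable (fun ω ↦ ‖T (x n ω) - x0‖) μ :=
    ((hTi n).sub (integrable_const x0)).norm
  have hVi (n : ℕ) : Integrable (fun ω ↦ ‖T (x (n + 1) ω) - T (x n ω)‖) μ :=
    ((hTi (n + 1)).sub (hTi n)).norm
  have hRi (n : ℕ) : Integrable (fun ω ↦ ‖x n ω - T (x n ω)‖) μ :=
    ((hxi n).sub (hTi n)).norm
  set s := mu * sig with hs
  have hs0 : 0 ≤ s := by positivity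
  have hκ0 : 0 ≤ κbar := (integral_nonneg fun _ ↦ norm_nonneg _).trans (hκbar 0)
  have hU (n : ℕ) : (∫ ω, ‖U (n + 1) ω‖ ∂μ) ≤ s / ((n : ℝ) + 1) ^ 2 := by
    simpa using hσn (n + 1) (by lia)
  set V : ℕ → ℝ := fun n ↦ ∫ ω, ‖T (x (n + 1) ω) - T (x n ω)‖ ∂μ with hV
  have hV0 : 2 * V 0 ≤ κbar + s := by
    have h : ∫ ω, 2 * ‖T (x 1 ω) - T (x 0 ω)‖ ∂μ ≤
        ∫ ω, (‖T (x 0 ω) - x0‖ + ‖U 1 ω‖) ∂μ := by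
      refine integral_mono ((hVi 0).const_mul 2) ((hKi 0).add (hUi 1)) fun ω ↦ ?_
      have h1 := hT (x 1 ω) (x 0 ω)
      have e : (2 : ℝ) • (x 1 ω - x 0 ω) = (T (x 0 ω) - x0) + U 1 ω := by
        have := hxs 0 ω
        norm_num at this
        rw [this, hx0]
        match_scalars <;> norm_num
      have h2 := norm_add_le (T (x 0 ω) - x0) (U 1 ω)
      rw [← e, norm_smul_of_nonneg (by norm_num)] at h2
      dsimp only
      linarith
    rw [integral_const_mul, integral_add (hKi 0) (hUi 1)] at h
    have := hU 0
    norm_num at this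
    change 2 * (∫ ω, ‖T (x 1 ω) - T (x 0 ω)‖ ∂μ) ≤ _
    linarith [hκbar 0]
  have hV1 : V 1 ≤ 2 * κbar := by
    have h : V 1 ≤ ∫ ω, (‖T (x 2 ω) - x0‖ + ‖T (x 1 ω) - x0‖) ∂μ := by
      refine integral_mono (hVi 1) ((hKi 2).add (hKi 1)) fun ω ↦ ?_
      have := norm_sub_le (T (x 2 ω) - x0) (T (x 1 ω) - x0)
      rwa [sub_sub_sub_cancel_right] at this
    rw [integral_add (hKi 2) (hKi 1)] at h
    linarith [hκbar 1, hκbar 2]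
  have hVstep (m : ℕ) : ((m : ℝ) + 3) * V (m + 1) ≤
      (m + 2) * V m + κbar / (m + 2) + 2 * s / (m + 1) := by
    have i1 := (hKi m).const_mul (1 / ((m : ℝ) + 2))
    have i2 := (hVi m).const_mul ((m : ℝ) + 2)
    have i3 := (hUi (m + 2)).const_mul ((m : ℝ) + 2)
    have i4 := (hUi (m + 1)).const_mul (((m : ℝ) + 1) * (m + 3) / (m + 2))
    have h := integral_mono ((hVi (m + 1)).const_mul ((m : ℝ) + 3)) (((i1.add i2).add i3).add i4)
      fun ω ↦ (mul_le_mul_of_nonneg_left (hT (x (m + 2) ω) (x (m + 1) ω))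
        (by positivity)).trans (norm_halpern_increment_le m (hxs m ω) (hxss m ω))
    rw [integral_add' ((i1.add i2).add i3) i4, integral_add' (i1.add i2) i3,
      integral_add' i1 i2] at h
    simp only [integral_const_mul] at h
    have k1 := mul_le_mul_of_nonneg_left (hκbar m) (by positivity : 0 ≤ 1 / ((m : ℝ) + 2))
    have k3 := mul_le_mul_of_nonneg_left (hU (m + 1)) (by positivity : 0 ≤ (m : ℝ) + 2)
    have k4 := mul_le_mul_of_nonneg_left (hU m)
      (by positivity : 0 ≤ ((m : ℝ) + 1) * (m + 3) / (m + 2))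
    have e : ((m : ℝ) + 2) * (s / (((m + 1 : ℕ) : ℝ) + 1) ^ 2) +
        ((m : ℝ) + 1) * (m + 3) / (m + 2) * (s / ((m : ℝ) + 1) ^ 2) = 2 * s / (m + 1) := by
      push_cast
      rw [show (m : ℝ) + 1 + 1 = m + 2 by ring]
      field_simp
      ring
    have e1 : 1 / ((m : ℝ) + 2) * κbar = κbar / (m + 2) := by ring
    simp only [hV]
    linarith
  intro N hN
  obtain ⟨n, rfl⟩ : ∃ n, N = n + 1 := ⟨N - 1, by lia⟩
  have hlog := log_bound_of_increment_le hκ0 hs0 (w := fun n ↦ ((n : ℝ) + 2) * V n)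
    (by simpa using hV0) (by norm_num; linarith)
    (fun m ↦ by
      have := hVstep m
      push_cast
      rwa [show (m : ℝ) + 1 + 2 = m + 3 by ring]) n
  have i2 := (hVi n).const_mul ((n : ℝ) + 1)
  have i3 := (hUi (n + 1)).const_mul ((n : ℝ) + 1)
  have h := integral_mono ((hRi (n + 1)).const_mul ((n : ℝ) + 2)) (((hKi (n + 1)).add i2).add i3)
    fun ω ↦ norm_halpern_residual_le n (hxs n ω)
  rw [integral_add' ((hKi (n + 1)).add i2) i3, integral_add' (hKi (n + 1)) i2] at h
  simp only [integral_const_mul] at h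
  have k3 := mul_le_mul_of_nonneg_left (hU n) (by positivity : 0 ≤ (n : ℝ) + 1)
  have e3 : ((n : ℝ) + 1) * (s / ((n : ℝ) + 1) ^ 2) = s / (n + 1) := by field_simp
  have e2 : ((n : ℝ) + 1) / (n + 2) * (((n : ℝ) + 2) * V n) = (n + 1) * V n := by field_simp
  rw [e2] at hlog
  simp only [hV] at hlog
  push_cast
  rw [show (n : ℝ) + 1 + 1 = n + 2 by ring, one_div_mul_eq_div, le_div_iff₀ (by positivity),
    show 2 * mu * sig = 2 * s by rw [hs]; ring, mul_comm]
  linarith [hκbar (n + 1)]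
end

section
/- (Resistant oracle properties) Fix p ∈ (0,1) and let ξ be a Bernoulli random variable with P(ξ = 1) = p, P(ξ = 0) = 1 − p. For x ∈ ℝ^d define the random vector T̃(x, ξ) ∈ ℝ^d by: if prog(x) < d then (T̃(x,ξ))_i = (Tx)_i for i ≠ prog(x)+1 and (T̃(x,ξ))_{prog(x)+1} = (ξ/p)(Tx)_{prog(x)+1}, while T̃(x,ξ) = Tx if prog(x) = d. Then for every x ∈ ℝ^d: E(T̃(x,ξ)) = Tx, and E‖Tx − T̃(x,ξ)‖₂² ≤ λ²(1−p)/p. In particular, if p = λ²/σ² ≤ 1 for a given σ > 0, then E‖Tx − T̃(x,ξ)‖₂² ≤ σ². -/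
open Finset MeasureTheory

/-- One-dimensional projection onto the interval `[0, lam]`. -/
noncomputable def projInterval (lam t : ℝ) : ℝ := max 0 (min lam t)

/-- The shift map `Q(x₁,…,x_D) = (lam − x_D, x₁, …, x_{D−1})` on `ℝ^(d+1)`. -/
noncomputable def shiftQ (d : ℕ) (lam : ℝ) (x : Fin (d + 1) → ℝ) : Fin (d + 1) → ℝ :=
  fun i => if h : i = 0 then lam - x (Fin.last d) else x (Fin.castSucc (i.pred h))

/-- Componentwise projection onto the cube `[0, lam]^(d+1)`. -/
noncomputable def projC (d : ℕ) (lam : ℝ) (x : Fin (d + 1) → ℝ) : Fin (d + 1) → ℝ :=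
  fun i => projInterval lam (x i)

/-- The operator `T = Q ∘ P_C`. -/
noncomputable def opT (d : ℕ) (lam : ℝ) (x : Fin (d + 1) → ℝ) : Fin (d + 1) → ℝ :=
  shiftQ d lam (projC d lam x)

open Classical in
/-- The progress of a vector: one plus the largest (0-based) index of a nonzero
coordinate, and `0` for the zero vector. -/
noncomputable def prog (d : ℕ) (x : Fin (d + 1) → ℝ) : ℕ :=
  (Finset.univ.filter fun i : Fin (d + 1) => 0 < |x i|).sup fun i => i.1 + 1

open Classical in
/-- The resistant stochastic oracle: multiply the coordinate just past the
progress of `x` by `v/p` (where `v` is the Bernoulli sample), leaving the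
others, and return `Tx` unchanged when `prog x` equals the dimension. -/
noncomputable def oracleT (d : ℕ) (lam p : ℝ) (x : Fin (d + 1) → ℝ) (v : ℝ) :
    Fin (d + 1) → ℝ :=
  fun i =>
    if prog d x < d + 1 ∧ (i : ℕ) = prog d x then (v / p) * opT d lam x i
    else opT d lam x i

/-- The projection onto `[0, lam]` lands in `[0, lam]`. -/
theorem projInterval_mem_Icc {lam : ℝ} (hlam : 0 ≤ lam) (t : ℝ) :
    projInterval lam t ∈ Set.Icc 0 lam :=
  ⟨le_max_left _ _, max_le hlam (min_le_left _ _)⟩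

/-- Every coordinate of `T x` lies in `[0, lam]`. -/
theorem opT_mem_Icc {d : ℕ} {lam : ℝ} (hlam : 0 ≤ lam) (x : Fin (d + 1) → ℝ)
    (i : Fin (d + 1)) : opT d lam x i ∈ Set.Icc 0 lam := by
  unfold opT shiftQ projC
  split_ifs
  · obtain ⟨h₀, h₁⟩ := projInterval_mem_Icc hlam (x (Fin.last d))
    exact ⟨by linarith, by linarith⟩
  · exact projInterval_mem_Icc hlam _

/-- The expectation of a function of a Bernoulli random variable. -/
theorem integral_comp_bernoulli {Ω : Type*} [MeasurableSpace Ω] {μ : Measure Ω}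
    [IsProbabilityMeasure μ] {p : ℝ} (hp₀ : 0 ≤ p) (hp₁ : p ≤ 1) {ξ : Ω → ℝ}
    (hξ : Measurable ξ) (hξ1 : μ (ξ ⁻¹' {1}) = ENNReal.ofReal p)
    (hξ0 : μ (ξ ⁻¹' {0}) = ENNReal.ofReal (1 - p)) (f : ℝ → ℝ) :
    ∫ ω, f (ξ ω) ∂μ = p * f 1 + (1 - p) * f 0 := by
  have hm₁ : MeasurableSet (ξ ⁻¹' {1}) := hξ (measurableSet_singleton 1)
  have hm₀ : MeasurableSet (ξ ⁻¹' {0}) := hξ (measurableSet_singleton 0)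
  have hdisj : Disjoint (ξ ⁻¹' {1}) (ξ ⁻¹' {0}) :=
    Disjoint.preimage ξ (Set.disjoint_singleton.2 one_ne_zero)
  have hunion : μ (ξ ⁻¹' {1} ∪ ξ ⁻¹' {0}) = 1 := by
    rw [measure_union hdisj hm₀, hξ1, hξ0, ← ENNReal.ofReal_add hp₀ (sub_nonneg.2 hp₁)]
    simp
  have hae : ∀ᵐ ω ∂μ, ω ∈ ξ ⁻¹' {1} ∪ ξ ⁻¹' {0} :=
    (prob_compl_eq_zero_iff (hm₁.union hm₀)).2 hunion
  have heq : (fun ω => f (ξ ω)) =ᵐ[μ] fun ω =>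
      (ξ ⁻¹' {1}).indicator (fun _ => f 1) ω + (ξ ⁻¹' {0}).indicator (fun _ => f 0) ω := by
    filter_upwards [hae] with ω hω
    rcases hω with h | h <;> simp only [Set.mem_preimage, Set.mem_singleton_iff] at h <;>
      simp [Set.indicator, h]
  rw [integral_congr_ae heq,
    integral_add ((integrable_const _).indicator hm₁) ((integrable_const _).indicator hm₀),
    integral_indicator_const _ hm₁, integral_indicator_const _ hm₀, measureReal_def,
    measureReal_def, hξ1, hξ0, ENNReal.toReal_ofReal hp₀,
    ENNReal.toReal_ofReal (sub_nonneg.2 hp₁), smul_eq_mul, smul_eq_mul]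

/-- The squared error of the oracle is concentrated on a single coordinate. -/
theorem sum_sq_opT_sub_oracleT_le {d : ℕ} {lam : ℝ} (hlam : 0 ≤ lam) (p : ℝ)
    (x : Fin (d + 1) → ℝ) (v : ℝ) :
    ∑ i, (opT d lam x i - oracleT d lam p x v i) ^ 2 ≤ lam ^ 2 * (1 - v / p) ^ 2 := by
  by_cases h : prog d x < d + 1
  · rw [Finset.sum_eq_single (⟨prog d x, h⟩ : Fin (d + 1))]
    · obtain ⟨h₀, h₁⟩ := opT_mem_Icc hlam x ⟨prog d x, h⟩
      have herr : opT d lam x ⟨prog d x, h⟩ - oracleT d lam p x v ⟨prog d x, h⟩ =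
          opT d lam x ⟨prog d x, h⟩ * (1 - v / p) := by
        simp only [oracleT, h, and_self, if_true]
        ring
      rw [herr, mul_pow]
      gcongr
    · intro i _ hi
      have hne : (i : ℕ) ≠ prog d x := fun hi' => hi (Fin.ext hi')
      simp [oracleT, hne]
    · simp
  · have hzero : ∑ i, (opT d lam x i - oracleT d lam p x v i) ^ 2 = 0 := by
      simp [oracleT, h]
    rw [hzero]
    positivity

/-- **Resistant oracle properties.** The oracle is unbiased and
has variance at most `lam²(1−p)/p`; in particular it has variance at most `σ²`
when `p = lam²/σ²`. -/
theorem resistant_oracle_unbiased_and_variance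
    (d : ℕ) (lam : ℝ) (hlam : 0 < lam)
    (Ω : Type*) [MeasurableSpace Ω] (μ : Measure Ω) [IsProbabilityMeasure μ]
    (p : ℝ) (hp : p ∈ Set.Ioo (0 : ℝ) 1)
    (ξ : Ω → ℝ) (hξ : Measurable ξ)
    (hξ1 : μ (ξ ⁻¹' {1}) = ENNReal.ofReal p)
    (hξ0 : μ (ξ ⁻¹' {0}) = ENNReal.ofReal (1 - p)) :
    (∀ (x : Fin (d + 1) → ℝ) (i : Fin (d + 1)),
        (∫ ω, oracleT d lam p x (ξ ω) i ∂μ) = opT d lam x i) ∧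
    (∀ x : Fin (d + 1) → ℝ,
        (∫ ω, ∑ i, (opT d lam x i - oracleT d lam p x (ξ ω) i) ^ 2 ∂μ) ≤
          lam ^ 2 * (1 - p) / p) ∧
    (∀ σ : ℝ, 0 < σ → p = lam ^ 2 / σ ^ 2 →
      ∀ x : Fin (d + 1) → ℝ,
        (∫ ω, ∑ i, (opT d lam x i - oracleT d lam p x (ξ ω) i) ^ 2 ∂μ) ≤ σ ^ 2) := by
  obtain ⟨hp₀, hp₁⟩ := hp
  have hE := integral_comp_bernoulli hp₀.le hp₁.le hξ hξ1 hξ0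
  have hvar : ∀ x : Fin (d + 1) → ℝ,
      (∫ ω, ∑ i, (opT d lam x i - oracleT d lam p x (ξ ω) i) ^ 2 ∂μ) ≤
        lam ^ 2 * (1 - p) / p := by
    intro x
    rw [hE fun v => ∑ i, (opT d lam x i - oracleT d lam p x v i) ^ 2]
    calc
      _ ≤ p * (lam ^ 2 * (1 - 1 / p) ^ 2) + (1 - p) * (lam ^ 2 * (1 - 0 / p) ^ 2) :=
        add_le_add
          (mul_le_mul_of_nonneg_left (sum_sq_opT_sub_oracleT_le hlam.le p x 1) hp₀.le)
          (mul_le_mul_of_nonneg_left (sum_sq_opT_sub_oracleT_le hlam.le p x 0)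
            (sub_nonneg.2 hp₁.le))
      _ = lam ^ 2 * (1 - p) / p := by
        field_simp
        ring
  refine ⟨fun x i => ?_, hvar, fun σ hσ hpσ x => (hvar x).trans ?_⟩
  · rw [hE fun v => oracleT d lam p x v i]
    unfold oracleT
    split_ifs
    · field_simp
      ring
    · ring
  · have hlamσ : lam ^ 2 = p * σ ^ 2 := by
      rw [hpσ]
      field_simp
    rw [hlamσ, div_le_iff₀ hp₀]
    nlinarith [mul_nonneg (mul_nonneg hp₀.le hp₀.le) (sq_nonneg σ)]
end
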